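/- arXiv:1608.04896 — 2 statements merged into one kernel-verified Lean document; each statement's English description precedes it below -/
import Mathlib

section
/- Derivative formula for the disk-exterior eigenvalue (equation (3.8) in the proof of Proposition 3.2): Let α < 0 and let k : (0,∞) → (0,∞) be a differentiable function satisfying k(R)·K₁(k(R)·R) + α·K₀(k(R)·R) = 0 for all R > 0. Set λ(R) := −k(R)². Then for every R > 0 with λ(R) + α² ≠ 0, λ′(R) = −(2/R)·λ(R)·(λ(R) + α² + α/R)/(λ(R) + α²). -/
open MeasureTheory Metric Set Bornology Real Filter

noncomputable section

/-- The Euclidean plane. -/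
abbrev E2 := EuclideanSpace ℝ (Fin 2)

/-- The exterior of a set: complement of its closure. -/
def extDom (Ω : Set E2) : Set E2 := (closure Ω)ᶜ

/-- The lowest Robin eigenvalue of the exterior of `Ω`, defined variationally as the
infimum of Rayleigh quotients over smooth compactly supported test functions that are
not identically zero on the exterior. -/
def robinEig (α : ℝ) (Ω : Set E2) : ℝ :=
  sInf { q : ℝ | ∃ u : E2 → ℝ, ContDiff ℝ (⊤ : ℕ∞) u ∧ HasCompactSupport u ∧
    (∃ x ∈ extDom Ω, u x ≠ 0) ∧
    q = ((∫ x in extDom Ω, ‖fderiv ℝ u x‖ ^ 2) +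
          α * ∫ x in frontier Ω, (u x) ^ 2 ∂(μH[1])) /
        (∫ x in extDom Ω, (u x) ^ 2) }

/-- A planar set has smooth boundary if its topological boundary is the image of a
smooth, periodic, regular, injective (on one period) closed curve. -/
def HasSmoothBoundary (Ω : Set E2) : Prop :=
  ∃ γ : ℝ → E2, ContDiff ℝ (⊤ : ℕ∞) γ ∧ (∀ t, γ (t + 1) = γ t) ∧
    (∀ t, deriv γ t ≠ 0) ∧ InjOn γ (Ico 0 1) ∧ range γ = frontier Ω

/-- Modified Bessel function of the second kind `K₀`, via its integral representation. -/
def K0 (x : ℝ) : ℝ := ∫ t in Ioi (0:ℝ), Real.exp (-x * Real.cosh t)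

/-- Modified Bessel function of the second kind `K₁`, via its integral representation. -/
def K1 (x : ℝ) : ℝ := ∫ t in Ioi (0:ℝ), Real.exp (-x * Real.cosh t) * Real.cosh t

/-- The exponential beats powers: `exp (-x y) yⁿ ≤ n! (2/x)ⁿ exp (-(x/2) y)`. -/
theorem exp_neg_mul_mul_pow_le {x y : ℝ} (hx : 0 < x) (hy : 0 ≤ y) (n : ℕ) :
    Real.exp (-x * y) * y ^ n ≤
      n.factorial * (2 / x) ^ n * Real.exp (-(x / 2) * y) := by
  have h := Real.pow_div_factorial_le_exp (x / 2 * y) (by positivity) n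
  rw [div_le_iff₀ (by positivity)] at h
  have hy' : y ^ n = (2 / x) ^ n * (x / 2 * y) ^ n := by
    rw [← mul_pow]; congr 1; field_simp
  have he : Real.exp (-(x / 2) * y) = Real.exp (-x * y) * Real.exp (x / 2 * y) := by
    rw [← Real.exp_add]; congr 1; ring
  calc Real.exp (-x * y) * y ^ n
      = Real.exp (-x * y) * (2 / x) ^ n * (x / 2 * y) ^ n := by rw [hy']; ring
    _ ≤ Real.exp (-x * y) * (2 / x) ^ n * (Real.exp (x / 2 * y) * n.factorial) := by gcongr
    _ = n.factorial * (2 / x) ^ n * Real.exp (-(x / 2) * y) := by rw [he]; ring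

theorem exp_neg_mul_cosh_mul_cosh_pow_le {x t : ℝ} (hx : 0 < x) (ht : 0 ≤ t) (n : ℕ) :
    Real.exp (-x * Real.cosh t) * Real.cosh t ^ n ≤
      n.factorial * (2 / x) ^ n * Real.exp (-(x / 2) * t) := by
  refine (exp_neg_mul_mul_pow_le hx (Real.cosh_pos t).le n).trans ?_
  have : t ≤ Real.cosh t := (Real.self_le_sinh_iff.2 ht).trans (Real.sinh_lt_cosh t).le
  gcongr _ * Real.exp ?_
  nlinarith

theorem integrableOn_exp_neg_mul_cosh_mul_cosh_pow {x : ℝ} (hx : 0 < x) (n : ℕ) :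
    IntegrableOn (fun t => Real.exp (-x * Real.cosh t) * Real.cosh t ^ n) (Ioi 0) := by
  refine Integrable.mono' ((integrableOn_exp_mul_Ioi (a := -(x / 2)) (by linarith) 0).const_mul
    (n.factorial * (2 / x) ^ n)) (by fun_prop) ?_
  refine (ae_restrict_iff' measurableSet_Ioi).2 (ae_of_all _ fun t ht => ?_)
  have := Real.cosh_pos t
  rw [Real.norm_of_nonneg (by positivity)]
  exact exp_neg_mul_cosh_mul_cosh_pow_le hx (le_of_lt ht) n

theorem hasDerivAt_integral_exp_neg_mul_cosh_mul_cosh_pow {x : ℝ} (hx : 0 < x) (n : ℕ) :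
    HasDerivAt (fun y => ∫ t in Ioi (0:ℝ), Real.exp (-y * Real.cosh t) * Real.cosh t ^ n)
      (-∫ t in Ioi (0:ℝ), Real.exp (-x * Real.cosh t) * Real.cosh t ^ (n + 1)) x := by
  rw [← integral_neg]
  refine (hasDerivAt_integral_of_dominated_loc_of_deriv_le
    (μ := volume.restrict (Ioi (0:ℝ)))
    (F := fun y t => Real.exp (-y * Real.cosh t) * Real.cosh t ^ n)
    (F' := fun y t => -(Real.exp (-y * Real.cosh t) * Real.cosh t ^ (n + 1)))
    (bound := fun t => Real.exp (-(x / 2) * Real.cosh t) * Real.cosh t ^ (n + 1))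
    (Metric.ball_mem_nhds x (half_pos hx)) (Eventually.of_forall fun y => by fun_prop)
    (integrableOn_exp_neg_mul_cosh_mul_cosh_pow hx n) (by fun_prop)
    (ae_of_all _ fun t y hy => ?_)
    (integrableOn_exp_neg_mul_cosh_mul_cosh_pow (half_pos hx) (n + 1))
    (ae_of_all _ fun t y _ => ?_)).2
  · have hc := Real.cosh_pos t
    rw [norm_neg, Real.norm_of_nonneg (by positivity)]
    rw [Metric.mem_ball, Real.dist_eq, abs_lt] at hy
    gcongr
    linarith
  · have h := (((hasDerivAt_id y).neg.mul_const (Real.cosh t)).exp).mul_const (Real.cosh t ^ n)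
    refine h.congr_deriv ?_
    simp only [Pi.neg_apply, id]
    ring

theorem hasDerivAt_K0 {x : ℝ} (hx : 0 < x) : HasDerivAt K0 (-K1 x) x := by
  have h := hasDerivAt_integral_exp_neg_mul_cosh_mul_cosh_pow hx 0
  simp only [pow_zero, mul_one, zero_add, pow_one] at h
  exact h

/-- Integration by parts against `exp (-x cosh t) sinh t`. -/
theorem mul_integral_exp_neg_mul_cosh_mul_cosh_sq {x : ℝ} (hx : 0 < x) :
    x * ∫ t in Ioi (0:ℝ), Real.exp (-x * Real.cosh t) * Real.cosh t ^ 2 = x * K0 x + K1 x := by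
  have h0 := integrableOn_exp_neg_mul_cosh_mul_cosh_pow hx 0
  have h1 := integrableOn_exp_neg_mul_cosh_mul_cosh_pow hx 1
  have h2 := integrableOn_exp_neg_mul_cosh_mul_cosh_pow hx 2
  simp only [pow_zero, mul_one, pow_one] at h0 h1
  have hderiv : ∀ t ∈ Ici (0:ℝ), HasDerivAt
      (fun t => Real.exp (-x * Real.cosh t) * Real.sinh t)
      (x * (Real.exp (-x * Real.cosh t)) + Real.exp (-x * Real.cosh t) * Real.cosh t
        - x * (Real.exp (-x * Real.cosh t) * Real.cosh t ^ 2)) t := fun t _ => by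
    refine ((((Real.hasDerivAt_cosh t).const_mul (-x)).exp).mul
      (Real.hasDerivAt_sinh t)).congr_deriv ?_
    rw [Real.cosh_sq]
    ring
  have hlim : Tendsto (fun t => Real.exp (-x * Real.cosh t) * Real.sinh t) atTop (nhds 0) := by
    have hexp : Tendsto (fun t : ℝ => ((1 : ℕ).factorial * (2 / x) ^ 1) *
        Real.exp (-(x / 2) * t)) atTop (nhds 0) := by
      rw [← mul_zero ((1 : ℕ).factorial * (2 / x) ^ 1 : ℝ)]
      exact (Real.tendsto_exp_atBot.comp
        (tendsto_id.const_mul_atTop_of_neg (by linarith : -(x / 2) < 0))).const_mul _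
    refine squeeze_zero' ?_ ?_ hexp
    · filter_upwards [eventually_ge_atTop 0] with t ht
      exact mul_nonneg (Real.exp_pos _).le (Real.sinh_nonneg_iff.2 ht)
    · filter_upwards [eventually_ge_atTop 0] with t ht
      refine le_trans ?_ (exp_neg_mul_cosh_mul_cosh_pow_le hx ht 1)
      rw [pow_one]
      gcongr
      exact (Real.sinh_lt_cosh t).le
  have h := integral_Ioi_of_hasDerivAt_of_tendsto' hderiv
    (((h0.const_mul x).add h1).sub (h2.const_mul x)) hlim
  have hadd : ∫ t in Ioi (0:ℝ), (x * Real.exp (-x * Real.cosh t) +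
      Real.exp (-x * Real.cosh t) * Real.cosh t) = x * K0 x + K1 x := by
    rw [integral_add (h0.const_mul x) h1, integral_const_mul, K0, K1]
  erw [integral_sub ((h0.const_mul x).add h1) (h2.const_mul x)] at h
  erw [hadd, integral_const_mul] at h
  simp only [Real.sinh_zero, mul_zero, sub_zero] at h
  linarith

theorem hasDerivAt_K1 {x : ℝ} (hx : 0 < x) : HasDerivAt K1 (-(K0 x + K1 x / x)) x := by
  have h := hasDerivAt_integral_exp_neg_mul_cosh_mul_cosh_pow hx 1
  simp only [pow_one] at h
  refine HasDerivAt.congr_deriv (f := K1) h ?_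
  have := mul_integral_exp_neg_mul_cosh_mul_cosh_sq hx
  rw [one_add_one_eq_two, neg_inj, ← mul_right_inj' hx.ne', this]
  field_simp

theorem K0_pos {x : ℝ} (hx : 0 < x) : 0 < K0 x := by
  have : NeZero (volume.restrict (Ioi (0:ℝ))) := ⟨by simp⟩
  refine integral_exp_pos ?_
  simpa [IntegrableOn] using integrableOn_exp_neg_mul_cosh_mul_cosh_pow hx 0

/-- Derivative formula for the disk-exterior eigenvalue with respect to the radius. -/
theorem robinEig_ball_deriv_formula
    (α : ℝ) (hα : α < 0) (k : ℝ → ℝ)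
    (hkpos : ∀ R, 0 < R → 0 < k R)
    (hkdiff : ∀ R, 0 < R → DifferentiableAt ℝ k R)
    (heq : ∀ R, 0 < R → k R * K1 (k R * R) + α * K0 (k R * R) = 0)
    (R : ℝ) (hR : 0 < R) (hne : -(k R) ^ 2 + α ^ 2 ≠ 0) :
    deriv (fun R => -(k R) ^ 2) R =
      -(2 / R) * (-(k R) ^ 2) * ((-(k R) ^ 2) + α ^ 2 + α / R) /
        ((-(k R) ^ 2) + α ^ 2) := by
  have hk := hkpos R hR
  have hx : 0 < k R * R := mul_pos hk hR
  have hkR := (hkdiff R hR).hasDerivAt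
  have hkx : HasDerivAt (fun r => k r * r) (deriv k R * R + k R * 1) R :=
    hkR.mul (hasDerivAt_id R)
  have hF := (hkR.mul ((hasDerivAt_K1 hx).comp (h := fun r => k r * r) R hkx)).add
    (((hasDerivAt_K0 hx).comp (h := fun r => k r * r) R hkx).const_mul α)
  have hzero := hF.unique ((hasDerivAt_const R (0:ℝ)).congr_of_eventuallyEq
    (by filter_upwards [lt_mem_nhds hR] with r hr using heq r hr))
  have hK0 := K0_pos hx
  have hK1 : K1 (k R * R) = -(α * K0 (k R * R)) / k R := by
    rw [eq_div_iff hk.ne']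
    linarith [heq R hR]
  simp only [Function.comp_apply, hK1] at hzero
  have hsq := (hkR.pow 2).neg
  rw [show (fun R => -(k R) ^ 2) = -(k ^ 2) from rfl, hsq.deriv]
  generalize deriv k R = k' at *
  have hk' : k' * R * (-(k R) ^ 2 + α ^ 2) = -k R * (-(k R) ^ 2 + α ^ 2 + α / R) := by
    field_simp at hzero ⊢
    replace hzero := (mul_eq_zero.1 (hzero.trans (mul_zero _))).resolve_left hK0.ne'
    linear_combination hzero
  rw [eq_div_iff hne]
  field_simp at hk' ⊢
  linear_combination (-2 * k R) * hk'

end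
end

section
/- Test-function bound via parallel coordinates (inequality (4.5) in the proof of Theorem 1): Let α ∈ ℝ and let Ω ⊂ ℝ² be a nonempty convex bounded open set with smooth boundary, and set L := H¹(∂Ω). Then for every smooth compactly supported function ψ : [0,∞) → ℝ that is not identically zero, λ₁^α(Ω^ext) ≤ ( ∫₀^∞ ψ′(t)²·(L + 2πt) dt + α·L·ψ(0)² ) / ( ∫₀^∞ ψ(t)²·(L + 2πt) dt ). -/
open MeasureTheory Metric Set Bornology Real Filter

noncomputable section

open scoped ContDiff NNReal Topology

/-- A real-valued `1`-Lipschitz function is a uniform limit of smooth `1`-Lipschitz functions. -/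
lemma LipschitzWith.exists_contDiff_lipschitz_dist_le {f : E2 → ℝ} (hf : LipschitzWith 1 f)
    {δ : ℝ} (hδ : 0 < δ) :
    ∃ g : E2 → ℝ, ContDiff ℝ ∞ g ∧ LipschitzWith 1 g ∧ ∀ x, |g x - f x| ≤ δ := by
  let φ : ContDiffBump (0 : E2) := ⟨δ / 2, δ, half_pos hδ, half_lt_self hδ⟩
  have hφc : HasCompactSupport (φ.normed volume) := φ.hasCompactSupport_normed
  have hint : ∀ x, Integrable (fun y => φ.normed volume y * f (x - y)) := fun x =>
    (φ.continuous_normed.mul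
      (hf.continuous.comp (continuous_const.sub continuous_id))).integrable_of_hasCompactSupport
      hφc.mul_right
  refine ⟨convolution (φ.normed volume) f (ContinuousLinearMap.lsmul ℝ ℝ) volume,
    hφc.contDiff_convolution_left _ φ.contDiff_normed
      hf.continuous.locallyIntegrable, ?_, fun x => ?_⟩
  · refine LipschitzWith.of_dist_le_mul fun x y => ?_
    simp only [convolution_def, ContinuousLinearMap.lsmul_apply, smul_eq_mul, NNReal.coe_one,
      one_mul]
    rw [Real.dist_eq, ← integral_sub (hint x) (hint y)]
    calc |∫ a, (φ.normed volume a * f (x - a) - φ.normed volume a * f (y - a))|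
        ≤ ∫ a, |φ.normed volume a * f (x - a) - φ.normed volume a * f (y - a)| :=
          abs_integral_le_integral_abs
      _ ≤ ∫ a, φ.normed volume a * dist x y := by
          refine integral_mono ((hint x).sub (hint y)).abs
            (φ.integrable_normed.mul_const _) fun a => ?_
          simp only
          rw [← mul_sub, abs_mul, abs_of_nonneg (φ.nonneg_normed a)]
          refine mul_le_mul_of_nonneg_left ?_ (φ.nonneg_normed a)
          simpa [Real.dist_eq] using hf.dist_le_mul (x - a) (y - a)
      _ = dist x y := by rw [integral_mul_const, φ.integral_normed, one_mul]
  · rw [← Real.dist_eq]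
    refine φ.dist_normed_convolution_le hf.continuous.aestronglyMeasurable fun y hy => ?_
    simpa using (hf.dist_le_mul y x).trans (by simpa using (mem_ball.1 hy).le)

lemma support_comp_subset_cthickening {f : ℝ → ℝ} {K : Set E2} (hK : K.Nonempty)
    {R δ : ℝ} (hf : ∀ t, R < t → f t = 0) {ρ : E2 → ℝ} (hρ : ∀ x, |ρ x - infDist x K| ≤ δ) :
    Function.support (fun x => f (ρ x)) ⊆ cthickening (R + δ) K := by
  intro x hx
  have h1 : ρ x ≤ R := by
    by_contra! h
    exact hx (hf _ h)
  have h2 := (abs_le.1 (hρ x)).1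
  have h3 : infDist x K ≤ R + δ := by linarith
  rw [mem_cthickening_iff]
  rw [← ENNReal.ofReal_toReal (infEDist_ne_top hK)]
  exact ENNReal.ofReal_le_ofReal h3

lemma HasCompactSupport.exists_forall_lt_eq_zero {f : ℝ → ℝ} (hf : HasCompactSupport f) :
    ∃ R, ∀ t, R < t → f t = 0 := by
  obtain ⟨R, hR⟩ := hf.isCompact.isBounded.subset_closedBall 0
  refine ⟨R, fun t ht => ?_⟩
  by_contra h
  have := hR (subset_tsupport f h)
  simp only [mem_closedBall, dist_zero_right, Real.norm_eq_abs] at this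
  linarith [le_abs_self t]

/-- Integrals of `f ∘ ρ n` converge to the integral of `f (infDist · K)` when `ρ n` converges
uniformly to the distance function of the bounded set `K`. -/
lemma tendsto_integral_comp_infDist {μ : Measure E2} [IsFiniteMeasureOnCompacts μ]
    {K : Set E2} (hK : K.Nonempty) (hKb : IsBounded K) {f : ℝ → ℝ} (hf : Continuous f)
    (hfs : HasCompactSupport f) {ρ : ℕ → E2 → ℝ} (hρc : ∀ n, Continuous (ρ n))
    (hρ : ∀ n x, |ρ n x - infDist x K| ≤ 1 / ((n : ℝ) + 1)) :
    Tendsto (fun n => ∫ x, f (ρ n x) ∂μ) atTop (𝓝 (∫ x, f (infDist x K) ∂μ)) := by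
  obtain ⟨R, hR⟩ := hfs.exists_forall_lt_eq_zero
  obtain ⟨C, hC⟩ := hfs.exists_bound_of_continuous hf
  have hcpt : IsCompact (cthickening (R + 1) K) :=
    isCompact_of_isClosed_isBounded isClosed_cthickening hKb.cthickening
  refine tendsto_integral_of_dominated_convergence
    (indicator (cthickening (R + 1) K) fun _ => C)
    (fun n => (hf.comp (hρc n)).aestronglyMeasurable) ?_ ?_ ?_
  · exact (integrable_indicator_iff hcpt.measurableSet).2
      (integrableOn_const (hs := hcpt.measure_lt_top.ne))
  · refine fun n => Eventually.of_forall fun x => ?_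
    by_cases hx : x ∈ cthickening (R + 1) K
    · rw [indicator_of_mem hx]
      exact hC _
    · have hn : 1 / ((n : ℝ) + 1) ≤ 1 := by
        rw [div_le_one (by positivity)]
        linarith [n.cast_nonneg (α := ℝ)]
      have : f (ρ n x) = 0 := by_contra fun h => hx
        (support_comp_subset_cthickening hK hR (fun y => (hρ n y).trans hn) h)
      rw [this, indicator_of_notMem hx, norm_zero]
  · refine Eventually.of_forall fun x => (hf.tendsto _).comp ?_
    refine tendsto_iff_norm_sub_tendsto_zero.2
      (squeeze_zero (fun n => norm_nonneg _) (fun n => hρ n x) ?_)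
    exact tendsto_one_div_add_atTop_nhds_zero_nat

lemma E2.inner_eq (x y : E2) : inner ℝ x y = x 0 * y 0 + x 1 * y 1 := by
  simp [PiLp.inner_apply, Fin.sum_univ_two, mul_comm]

lemma E2.norm_sq_eq (x : E2) : ‖x‖ ^ 2 = x 0 ^ 2 + x 1 ^ 2 := by
  rw [← real_inner_self_eq_norm_sq, E2.inner_eq]; ring

lemma hasDerivAt_coord {γ : ℝ → E2} (hγ : ContDiff ℝ ∞ γ) (s : ℝ) (i : Fin 2) :
    HasDerivAt (fun r => γ r i) (deriv γ s i) s :=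
  (EuclideanSpace.proj (𝕜 := ℝ) i).hasFDerivAt.comp_hasDerivAt s
    (hγ.differentiable (by simp) s).hasDerivAt

/-- A smooth parametrization `γ` of the boundary of a convex set `Ω` over `[0, 1)`, together with
its outer unit normal field `N`; the sign `ε` records the orientation of `γ`. -/
structure OuterNormalFrame (Ω : Set E2) (γ N : ℝ → E2) (ε : ℝ) : Prop where
  contDiff_curve : ContDiff ℝ ∞ γ
  contDiff_normal : ContDiff ℝ ∞ N
  deriv_ne_zero : ∀ s, deriv γ s ≠ 0
  injOn : InjOn γ (Ico 0 1)
  image_eq : γ '' Ico 0 1 = frontier Ω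
  mem_frontier : ∀ s, γ s ∈ frontier Ω
  sign_sq : ε ^ 2 = 1
  norm_normal : ∀ s, ‖N s‖ = 1
  deriv_zero : ∀ s, deriv γ s 0 = -(ε * ‖deriv γ s‖ * N s 1)
  deriv_one : ∀ s, deriv γ s 1 = ε * ‖deriv γ s‖ * N s 0
  inner_lt : ∀ s, ∀ y ∈ Ω, inner ℝ (N s) (y - γ s) < 0

/-- A vector normal to the curve `γ` at an extremal point of a linear functional. -/
lemma inner_deriv_eq_zero_of_forall_le {γ : ℝ → E2} (hγ : ContDiff ℝ ∞ γ) {ν : E2} {s : ℝ}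
    (h : ∀ r, inner ℝ ν (γ r - γ s) ≤ 0) : inner ℝ ν (deriv γ s) = 0 := by
  have hd : HasDerivAt (fun r => inner ℝ ν (γ r - γ s)) (inner ℝ ν (deriv γ s)) s := by
    have := ((hγ.differentiable (by simp) s).hasDerivAt.sub_const (γ s))
    simpa using (hasDerivAt_const s ν).inner ℝ this
  refine IsLocalMax.hasDerivAt_eq_zero (Eventually.of_forall fun r => ?_) hd
  simpa using h r

lemma eq_smul_of_inner_eq_zero {ν w n : E2} {c : ℝ} (hc : c ≠ 0) (hn : ‖n‖ = 1)
    (h0 : w 0 = -(c * n 1)) (h1 : w 1 = c * n 0) (h : inner ℝ ν w = 0) :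
    ν = inner ℝ ν n • n := by
  rw [E2.inner_eq, h0, h1] at h
  have hn2 := E2.norm_sq_eq n
  rw [hn] at hn2
  have h' : ν 1 * n 0 = ν 0 * n 1 := by
    apply mul_left_cancel₀ hc; linarith
  ext i
  fin_cases i
  · simp [E2.inner_eq]; linear_combination ν 0 * hn2 - n 1 * h'
  · simp [E2.inner_eq]; linear_combination ν 1 * hn2 + n 0 * h'

/-- A strictly supporting normal vector at a boundary point of an open convex set. -/
lemma exists_inner_lt_of_mem_frontier {Ω : Set E2} (ho : IsOpen Ω) (hconv : Convex ℝ Ω) {p : E2}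
    (hp : p ∈ frontier Ω) : ∃ ν : E2, ∀ y ∈ Ω, inner ℝ ν (y - p) < 0 := by
  have hp' : p ∉ Ω := by
    rw [ho.frontier_eq] at hp
    exact hp.2
  obtain ⟨f, hf⟩ := geometric_hahn_banach_open_point hconv ho hp'
  refine ⟨(InnerProductSpace.toDual ℝ E2).symm f, fun y hy => ?_⟩
  rw [InnerProductSpace.toDual_symm_apply, map_sub]
  linarith [hf y hy]

lemma inner_le_of_mem_closure {Ω : Set E2} {p ν : E2}
    (h : ∀ y ∈ Ω, inner ℝ ν (y - p) < 0) {y : E2} (hy : y ∈ closure Ω) :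
    inner ℝ ν (y - p) ≤ 0 := by
  refine closure_minimal (t := {y | inner ℝ ν (y - p) ≤ 0}) (fun z hz => (h z hz).le) ?_ hy
  exact isClosed_le (by fun_prop) continuous_const

lemma exists_outerNormalFrame {Ω : Set E2} (hne : Ω.Nonempty) (ho : IsOpen Ω)
    (hconv : Convex ℝ Ω) (hsm : HasSmoothBoundary Ω) :
    ∃ γ N ε, OuterNormalFrame Ω γ N ε := by
  obtain ⟨γ, hγ, hper, hreg, hinj, hrange⟩ := hsm
  obtain ⟨x₀, hx₀⟩ := hne
  have hmem : ∀ s, γ s ∈ frontier Ω := fun s => hrange ▸ mem_range_self s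
  have hdγ : ContDiff ℝ ∞ (deriv γ) := (contDiff_infty_iff_deriv.1 hγ).2
  have hpos : ∀ s, 0 < ‖deriv γ s‖ := fun s => norm_pos_iff.2 (hreg s)
  let M : ℝ → E2 := fun s => ‖deriv γ s‖⁻¹ • !₂[deriv γ s 1, -deriv γ s 0]
  have hM : ContDiff ℝ ∞ M := by
    refine ((hdγ.norm ℝ hreg).inv fun s => (hpos s).ne').smul ?_
    refine contDiff_euclidean.2 fun i => ?_
    have := contDiff_euclidean.1 hdγ
    fin_cases i
    · simpa using this 1
    · simpa using (this 0).neg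
  have hM0 : ∀ s, deriv γ s 0 = -(‖deriv γ s‖ * M s 1) := fun s => by
    simp [M, (hpos s).ne']
  have hM1 : ∀ s, deriv γ s 1 = ‖deriv γ s‖ * M s 0 := fun s => by
    simp [M, (hpos s).ne']
  have hMn : ∀ s, ‖M s‖ = 1 := fun s => by
    have h1 := E2.norm_sq_eq (deriv γ s)
    have h2 := E2.norm_sq_eq (M s)
    rw [hM0, hM1] at h1
    have h3 : ‖M s‖ ^ 2 = 1 := by
      have := (pow_pos (hpos s) 2).ne'
      apply mul_left_cancel₀ this
      rw [h2]; linarith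
    exact (pow_eq_one_iff_of_nonneg (norm_nonneg _) two_ne_zero).1 h3
  have hsupp : ∀ s, ∃ c : ℝ, c ≠ 0 ∧ ∀ y ∈ Ω, c * inner ℝ (M s) (y - γ s) < 0 := fun s => by
    obtain ⟨ν, hν⟩ := exists_inner_lt_of_mem_frontier ho hconv (hmem s)
    have h0 := inner_deriv_eq_zero_of_forall_le hγ (ν := ν) (s := s) fun r =>
      inner_le_of_mem_closure hν (frontier_subset_closure (hmem r))
    have h1 := eq_smul_of_inner_eq_zero (hpos s).ne' (hMn s) (hM0 s) (hM1 s) h0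
    have h2 : ∀ y ∈ Ω, inner ℝ ν (M s) * inner ℝ (M s) (y - γ s) < 0 := fun y hy => by
      have := hν y hy
      rw [h1, inner_smul_left] at this
      simpa using this
    refine ⟨_, fun hc => ?_, h2⟩
    have := h2 x₀ hx₀
    rw [hc, zero_mul] at this
    exact lt_irrefl _ this
  have hcont : Continuous fun s => (inner ℝ (M s) (x₀ - γ s) : ℝ) :=
    hM.continuous.inner (continuous_const.sub hγ.continuous)
  have hne0 : ∀ s, (inner ℝ (M s) (x₀ - γ s) : ℝ) ≠ 0 := fun s h => by
    obtain ⟨c, -, hc⟩ := hsupp s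
    simpa [h] using hc x₀ hx₀
  obtain ⟨ε, hε, hsign⟩ : ∃ ε : ℝ, ε ^ 2 = 1 ∧ ∀ s, ε * inner ℝ (M s) (x₀ - γ s) < 0 := by
    rcases (hne0 0).lt_or_gt with h | h
    · refine ⟨1, by norm_num, fun s => ?_⟩
      rw [one_mul]
      by_contra! hs
      obtain ⟨r, hr⟩ := mem_range_of_exists_le_of_exists_ge hcont ⟨0, h.le⟩ ⟨s, hs⟩
      exact hne0 r hr
    · refine ⟨-1, by norm_num, fun s => ?_⟩
      by_contra! hs
      obtain ⟨r, hr⟩ := mem_range_of_exists_le_of_exists_ge hcont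
        ⟨s, by linarith⟩ ⟨0, h.le⟩
      exact hne0 r hr
  have himage : γ '' Ico 0 1 = frontier Ω := by
    rw [← hrange]
    refine Subset.antisymm (image_subset_range _ _) ?_
    rintro _ ⟨s, rfl⟩
    have hp : Function.Periodic γ 1 := hper
    obtain ⟨y, hy, h⟩ := hp.exists_mem_Ico₀ one_pos s
    exact ⟨y, hy, h.symm⟩
  have hε0 : ε ≠ 0 := by
    rintro rfl
    norm_num at hε
  refine ⟨γ, fun s => ε • M s, ε, hγ, hM.const_smul ε, hreg, hinj, himage, hmem, hε,
    fun s => ?_, fun s => ?_, fun s => ?_, fun s y hy => ?_⟩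
  · rw [norm_smul, hMn, mul_one, Real.norm_eq_abs, ← sq_eq_sq₀ (abs_nonneg _) zero_le_one,
      sq_abs, hε, one_pow]
  · simp only [PiLp.smul_apply, smul_eq_mul]
    linear_combination hM0 s + (‖deriv γ s‖ * M s 1) * hε
  · simp only [PiLp.smul_apply, smul_eq_mul]
    linear_combination hM1 s - (‖deriv γ s‖ * M s 0) * hε
  · rw [real_inner_smul_left]
    obtain ⟨c, hc0, hc⟩ := hsupp s
    have h1 := mul_pos_of_neg_of_neg (hc y hy) (hc x₀ hx₀)
    have h2 : 0 < inner ℝ (M s) (y - γ s) * inner ℝ (M s) (x₀ - γ s) := by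
      have : 0 < c ^ 2 := by positivity
      refine pos_of_mul_pos_right (a := c ^ 2) ?_ this.le
      linarith
    have h3 := hsign s
    by_contra! h4
    have : 0 < ε ^ 2 * (inner ℝ (M s) (y - γ s) * inner ℝ (M s) (x₀ - γ s)) := by
      rw [hε, one_mul]; exact h2
    nlinarith

namespace OuterNormalFrame

variable {Ω : Set E2} {γ N : ℝ → E2} {ε : ℝ}

lemma inner_le (h : OuterNormalFrame Ω γ N ε) (s : ℝ) {y : E2} (hy : y ∈ closure Ω) :
    inner ℝ (N s) (y - γ s) ≤ 0 :=
  inner_le_of_mem_closure (h.inner_lt s) hy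

lemma sign_ne_zero (h : OuterNormalFrame Ω γ N ε) : ε ≠ 0 := by
  rintro rfl
  simpa using h.sign_sq

lemma abs_sign (h : OuterNormalFrame Ω γ N ε) : |ε| = 1 := by
  rw [← sq_eq_sq₀ (abs_nonneg _) zero_le_one, sq_abs, h.sign_sq, one_pow]

lemma speed_pos (h : OuterNormalFrame Ω γ N ε) (s : ℝ) : 0 < ‖deriv γ s‖ :=
  norm_pos_iff.2 (h.deriv_ne_zero s)

lemma continuous_speed (h : OuterNormalFrame Ω γ N ε) : Continuous fun s => ‖deriv γ s‖ :=
  (h.contDiff_curve.continuous_deriv (by simp)).norm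

/-- Points of `closure Ω` are at least as far from `γ s + t • N s` as the foot point `γ s`. -/
lemma sq_add_sq_le_dist_sq (h : OuterNormalFrame Ω γ N ε) (s : ℝ) {t : ℝ} (ht : 0 ≤ t) {y : E2}
    (hy : y ∈ closure Ω) : t ^ 2 + dist y (γ s) ^ 2 ≤ dist (γ s + t • N s) y ^ 2 := by
  have h1 : γ s + t • N s - y = t • N s - (y - γ s) := by abel
  rw [dist_eq_norm, dist_eq_norm, h1, norm_sub_sq_real (t • N s), norm_smul, h.norm_normal,
    real_inner_smul_left, Real.norm_eq_abs, mul_one, sq_abs]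
  nlinarith [h.inner_le s hy]

lemma infDist_eq (h : OuterNormalFrame Ω γ N ε) (s : ℝ) {t : ℝ} (ht : 0 ≤ t) :
    infDist (γ s + t • N s) (closure Ω) = t := by
  have hmem : γ s ∈ closure Ω := frontier_subset_closure (h.mem_frontier s)
  refine le_antisymm ((infDist_le_dist_of_mem hmem).trans ?_) ?_
  · simp [dist_eq_norm, norm_smul, h.norm_normal, abs_of_nonneg ht]
  · refine (le_infDist ⟨_, hmem⟩).2 fun y hy => ?_
    refine (sq_le_sq₀ ht dist_nonneg).1 ?_
    nlinarith [h.sq_add_sq_le_dist_sq s ht hy, sq_nonneg (dist y (γ s))]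

lemma eq_of_eq (h : OuterNormalFrame Ω γ N ε) {s s' t t' : ℝ} (hs : s ∈ Ico (0 : ℝ) 1)
    (hs' : s' ∈ Ico (0 : ℝ) 1) (ht : 0 ≤ t) (ht' : 0 ≤ t')
    (heq : γ s + t • N s = γ s' + t' • N s') : s = s' ∧ t = t' := by
  have htt : t = t' := by rw [← h.infDist_eq s ht, heq, h.infDist_eq s' ht']
  refine ⟨h.injOn hs hs' ?_, htt⟩
  have h1 := h.sq_add_sq_le_dist_sq s ht
    (frontier_subset_closure (h.mem_frontier s'))
  have h2 : dist (γ s + t • N s) (γ s') = t := by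
    rw [heq]
    simp [dist_eq_norm, norm_smul, h.norm_normal, abs_of_nonneg ht', htt]
  rw [h2] at h1
  have h3 : dist (γ s') (γ s) = 0 := by
    have : dist (γ s') (γ s) ^ 2 = 0 := le_antisymm (by linarith) (sq_nonneg _)
    exact pow_eq_zero_iff two_ne_zero |>.1 this
  exact (dist_eq_zero.1 h3).symm

lemma mem_extDom (h : OuterNormalFrame Ω γ N ε) (s : ℝ) {t : ℝ} (ht : 0 < t) :
    γ s + t • N s ∈ extDom Ω := fun hmem => by
  have := h.infDist_eq s ht.le
  rw [infDist_zero_of_mem hmem] at this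
  exact ht.ne this

lemma exists_of_mem_extDom (h : OuterNormalFrame Ω γ N ε) (hne : Ω.Nonempty) (hb : IsBounded Ω)
    (hconv : Convex ℝ Ω) {x : E2} (hx : x ∈ extDom Ω) :
    ∃ s ∈ Ico (0 : ℝ) 1, ∃ t > (0 : ℝ), γ s + t • N s = x := by
  have hcpt : IsCompact (closure Ω) := hb.isCompact_closure
  obtain ⟨p, hp, hpd⟩ := hcpt.exists_infDist_eq_dist hne.closure x
  have hle : ∀ y ∈ closure Ω, inner ℝ (x - p) (y - p) ≤ 0 := by
    refine (norm_eq_iInf_iff_real_inner_le_zero hconv.closure hp).1 ?_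
    rw [← dist_eq_norm, ← hpd, infDist_eq_iInf]
    simp [dist_eq_norm]
  have hxp : x - p ≠ 0 := fun h0 => hx (by rwa [sub_eq_zero.1 h0])
  have hpf : p ∈ frontier Ω := by
    refine ⟨hp, fun hpi => ?_⟩
    have h1 : ∀ᶠ r : ℝ in 𝓝 0, p + r • (x - p) ∈ interior Ω := by
      have hc : ContinuousAt (fun r : ℝ => p + r • (x - p)) 0 := by fun_prop
      refine hc.eventually_mem ?_
      simpa using isOpen_interior.mem_nhds hpi
    obtain ⟨r, hr, hr0⟩ := ((h1.filter_mono nhdsWithin_le_nhds).and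
      (self_mem_nhdsWithin (a := (0 : ℝ)) (s := Ioi 0))).exists
    have h2 := hle _ (subset_closure (interior_subset hr))
    rw [add_sub_cancel_left, real_inner_smul_right, real_inner_self_eq_norm_sq] at h2
    have h3 : 0 < ‖x - p‖ ^ 2 := by positivity
    exact absurd (mul_pos hr0 h3) (not_lt.2 h2)
  rw [← h.image_eq] at hpf
  obtain ⟨s, hs, rfl⟩ := hpf
  have h0 := inner_deriv_eq_zero_of_forall_le h.contDiff_curve (ν := x - γ s) (s := s) fun r =>
    hle _ (frontier_subset_closure (h.mem_frontier r))
  have h1 := eq_smul_of_inner_eq_zero (mul_ne_zero h.sign_ne_zero (h.speed_pos s).ne')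
    (h.norm_normal s) (h.deriv_zero s) (h.deriv_one s) h0
  refine ⟨s, hs, inner ℝ (x - γ s) (N s), ?_, by rw [← h1]; abel⟩
  obtain ⟨y, hy⟩ := hne
  have h2 := hle y (subset_closure hy)
  rw [h1, real_inner_smul_left] at h2
  have h3 := h.inner_lt s y hy
  refine lt_of_le_of_ne ?_ fun h4 => hxp ?_
  · by_contra! h4
    exact absurd (mul_pos_of_neg_of_neg h4 h3) (not_lt.2 h2)
  · rw [h1, ← h4, zero_smul]

lemma extDom_eq_image (h : OuterNormalFrame Ω γ N ε) (hne : Ω.Nonempty) (hb : IsBounded Ω)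
    (hconv : Convex ℝ Ω) :
    extDom Ω = (fun p : ℝ × ℝ => γ p.1 + p.2 • N p.1) '' (Ico 0 1 ×ˢ Ioi 0) := by
  ext x
  constructor
  · intro hx
    obtain ⟨s, hs, t, ht, rfl⟩ := h.exists_of_mem_extDom hne hb hconv hx
    exact ⟨(s, t), ⟨hs, ht⟩, rfl⟩
  · rintro ⟨p, hp, rfl⟩
    exact h.mem_extDom p.1 hp.2

/-- The curvature density `κ |γ'|` of the boundary curve, expressed through the normal field. -/
def _root_.curvDensity (N : ℝ → E2) (ε : ℝ) (s : ℝ) : ℝ :=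
  ε * (N s 0 * deriv N s 1 - N s 1 * deriv N s 0)

lemma continuous_curvDensity (h : OuterNormalFrame Ω γ N ε) :
    Continuous (curvDensity N ε) := by
  have h1 := h.contDiff_normal.continuous
  have h2 := h.contDiff_normal.continuous_deriv (by simp)
  have h3 : ∀ i, Continuous fun s => N s i := fun i => by fun_prop
  have h4 : ∀ i, Continuous fun s => deriv N s i := fun i => by fun_prop
  unfold curvDensity
  exact continuous_const.mul (((h3 0).mul (h4 1)).sub ((h3 1).mul (h4 0)))

lemma curvDensity_nonneg (h : OuterNormalFrame Ω γ N ε) (s : ℝ) : 0 ≤ curvDensity N ε s := by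
  have hmono : ∀ r, 0 ≤ inner ℝ (N r - N s) (γ r - γ s) := fun r => by
    have h1 := h.inner_le s (frontier_subset_closure (h.mem_frontier r))
    have h2 := h.inner_le r (frontier_subset_closure (h.mem_frontier s))
    have h3 : (inner ℝ (N r) (γ r - γ s) : ℝ) = - inner ℝ (N r) (γ s - γ r) := by
      rw [← inner_neg_right, neg_sub]
    rw [inner_sub_left]
    linarith
  have hN := (h.contDiff_normal.differentiable (by simp) s).hasDerivAt.tendsto_slope
  have hγ := (h.contDiff_curve.differentiable (by simp) s).hasDerivAt.tendsto_slope
  have hlim := ge_of_tendsto (hN.inner (𝕜 := ℝ) hγ) (b := 0) (Eventually.of_forall fun r => by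
    rw [slope_def_module, slope_def_module, real_inner_smul_left, real_inner_smul_right,
      ← mul_assoc]
    exact mul_nonneg (mul_self_nonneg _) (hmono r))
  rw [E2.inner_eq, h.deriv_zero, h.deriv_one] at hlim
  have h1 : deriv N s 0 * -(ε * ‖deriv γ s‖ * N s 1) + deriv N s 1 * (ε * ‖deriv γ s‖ * N s 0)
      = ‖deriv γ s‖ * curvDensity N ε s := by
    unfold curvDensity; ring
  rw [h1] at hlim
  exact nonneg_of_mul_nonneg_right hlim (h.speed_pos s)

/-- Change of variables to parallel coordinates. -/
lemma change_of_variables (h : OuterNormalFrame Ω γ N ε) (hne : Ω.Nonempty) (hb : IsBounded Ω)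
    (hconv : Convex ℝ Ω) (F : E2 → ℝ) :
    (IntegrableOn F (extDom Ω) ↔ IntegrableOn (fun p : ℝ × ℝ =>
      (‖deriv γ p.1‖ + p.2 * curvDensity N ε p.1) * F (γ p.1 + p.2 • N p.1))
        (Ico 0 1 ×ˢ Ioi 0)) ∧
    ∫ x in extDom Ω, F x = ∫ p in Ico (0 : ℝ) 1 ×ˢ Ioi (0 : ℝ),
      (‖deriv γ p.1‖ + p.2 * curvDensity N ε p.1) * F (γ p.1 + p.2 • N p.1) := by
  let e : E2 ≃ᵐ ℝ × ℝ :=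
    (MeasurableEquiv.toLp 2 (Fin 2 → ℝ)).symm.trans MeasurableEquiv.finTwoArrow
  have he : MeasurePreserving e volume volume :=
    (EuclideanSpace.volume_preserving_symm_measurableEquiv_toLp (Fin 2)).trans
      (volume_preserving_finTwoArrow ℝ)
  have he_apply : ∀ x : E2, e x = (x 0, x 1) := fun x => rfl
  let Φ : ℝ × ℝ → ℝ × ℝ := fun p => e (γ p.1 + p.2 • N p.1)
  let S : Set (ℝ × ℝ) := Ico 0 1 ×ˢ Ioi 0
  have hS : MeasurableSet S := measurableSet_Ico.prod measurableSet_Ioi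
  have hΦS : e '' extDom Ω = Φ '' S := by
    rw [h.extDom_eq_image hne hb hconv, image_image]
  let D : ℝ × ℝ → ℝ × ℝ →L[ℝ] ℝ × ℝ := fun p =>
    (Matrix.toLin (.finTwoProd ℝ) (.finTwoProd ℝ)
      !![deriv γ p.1 0 + p.2 * deriv N p.1 0, N p.1 0;
        deriv γ p.1 1 + p.2 * deriv N p.1 1, N p.1 1]).toContinuousLinearMap
  have hD : ∀ p, HasFDerivAt Φ (D p) p := fun p => by
    have hcoord : ∀ i, HasFDerivAt (fun q : ℝ × ℝ => γ q.1 i + q.2 * N q.1 i)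
        ((deriv γ p.1 i + p.2 * deriv N p.1 i) • ContinuousLinearMap.fst ℝ ℝ ℝ
          + N p.1 i • ContinuousLinearMap.snd ℝ ℝ ℝ) p := fun i => by
      have hfst : HasFDerivAt (Prod.fst : ℝ × ℝ → ℝ) (.fst ℝ ℝ ℝ) p := hasFDerivAt_fst
      have h1 := (hasDerivAt_coord h.contDiff_curve p.1 i).comp_hasFDerivAt p hfst
      have h2 := (hasDerivAt_coord h.contDiff_normal p.1 i).comp_hasFDerivAt p hfst
      refine (h1.add (hasFDerivAt_snd.mul h2)).congr_fderiv ?_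
      ext <;> simp
    have := (hcoord 0).prodMk (hcoord 1)
    simp only [D]
    rw [Matrix.toLin_finTwoProd_toContinuousLinearMap]
    exact this
  have hdet : ∀ p ∈ S, |(D p).det| = ‖deriv γ p.1‖ + p.2 * curvDensity N ε p.1 := fun p hp => by
    have h1 : (D p).det = -(ε * (‖deriv γ p.1‖ + p.2 * curvDensity N ε p.1)) := by
      simp only [D, LinearMap.det_toContinuousLinearMap, LinearMap.det_toLin,
        Matrix.det_fin_two_of, curvDensity]
      have hn := E2.norm_sq_eq (N p.1)
      rw [h.norm_normal] at hn
      rw [h.deriv_zero, h.deriv_one]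
      linear_combination (ε * ‖deriv γ p.1‖) * hn
        + p.2 * (N p.1 0 * deriv N p.1 1 - N p.1 1 * deriv N p.1 0) * h.sign_sq
    rw [h1, abs_neg, abs_mul, h.abs_sign, one_mul, abs_of_nonneg]
    exact add_nonneg (norm_nonneg _) (mul_nonneg (le_of_lt hp.2) (h.curvDensity_nonneg _))
  have hinj : InjOn Φ S := fun p hp q hq hpq => by
    have := h.eq_of_eq hp.1 hq.1 (le_of_lt hp.2) (le_of_lt hq.2) (e.injective hpq)
    exact Prod.ext this.1 this.2
  have hpre : extDom Ω = e ⁻¹' (e '' extDom Ω) := (preimage_image_eq _ e.injective).symm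
  have hF : F = (F ∘ e.symm) ∘ e := by ext; simp
  have hcongr : EqOn (fun p => |(D p).det| • (F ∘ e.symm) (Φ p)) (fun p : ℝ × ℝ =>
      (‖deriv γ p.1‖ + p.2 * curvDensity N ε p.1) * F (γ p.1 + p.2 • N p.1)) S := fun p hp => by
    simp only [hdet p hp, Φ, smul_eq_mul, Function.comp_apply, e.symm_apply_apply]
  constructor
  · rw [← integrableOn_congr_fun hcongr hS,
      ← integrableOn_image_iff_integrableOn_abs_det_fderiv_smul
      volume hS (fun p _ => (hD p).hasFDerivWithinAt) hinj, ← hΦS,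
      ← he.integrableOn_comp_preimage e.measurableEmbedding, ← hpre, ← hF]
  · rw [← setIntegral_congr_fun hS hcongr, ← integral_image_eq_integral_abs_det_fderiv_smul
      volume hS (fun p _ => (hD p).hasFDerivWithinAt) hinj, ← hΦS,
      ← he.setIntegral_preimage_emb e.measurableEmbedding, ← hpre]
    simp

lemma integrableOn_speed (h : OuterNormalFrame Ω γ N ε) :
    IntegrableOn (fun s => ‖deriv γ s‖) (Ico (0 : ℝ) 1) :=
  (h.continuous_speed.integrableOn_Icc).mono_set Ico_subset_Icc_self

lemma integrableOn_curvDensity (h : OuterNormalFrame Ω γ N ε) :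
    IntegrableOn (curvDensity N ε) (Ico (0 : ℝ) 1) :=
  (h.continuous_curvDensity.integrableOn_Icc).mono_set Ico_subset_Icc_self

/-- Integrals over the exterior of functions of the distance to `Ω`. -/
lemma setIntegral_comp_infDist (h : OuterNormalFrame Ω γ N ε) (hne : Ω.Nonempty)
    (hb : IsBounded Ω) (hconv : Convex ℝ Ω) {f : ℝ → ℝ}
    (hf : IntegrableOn (fun x => f (infDist x (closure Ω))) (extDom Ω)) :
    ∫ x in extDom Ω, f (infDist x (closure Ω)) = ∫ t in Ioi (0 : ℝ),
      f t * ((∫ s in Ico (0 : ℝ) 1, ‖deriv γ s‖) +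
        t * ∫ s in Ico (0 : ℝ) 1, curvDensity N ε s) := by
  obtain ⟨h1, h2⟩ := h.change_of_variables hne hb hconv fun x => f (infDist x (closure Ω))
  have hS : MeasurableSet (Ico (0 : ℝ) 1 ×ˢ Ioi (0 : ℝ)) :=
    measurableSet_Ico.prod measurableSet_Ioi
  have hcongr : EqOn (fun p : ℝ × ℝ => (‖deriv γ p.1‖ + p.2 * curvDensity N ε p.1) *
      f (infDist (γ p.1 + p.2 • N p.1) (closure Ω)))
      (fun p => (‖deriv γ p.1‖ + p.2 * curvDensity N ε p.1) * f p.2)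
      (Ico 0 1 ×ˢ Ioi 0) := fun p hp => by
    simp only [h.infDist_eq p.1 (le_of_lt hp.2)]
  rw [h2, setIntegral_congr_fun hS hcongr]
  have h3 := (integrableOn_congr_fun hcongr hS).1 (h1.1 hf)
  rw [IntegrableOn, Measure.volume_eq_prod, ← Measure.prod_restrict] at h3
  rw [Measure.volume_eq_prod, ← Measure.prod_restrict, integral_prod_symm _ h3]
  refine integral_congr_ae (Eventually.of_forall fun t => ?_)
  simp only
  rw [integral_mul_const, integral_add h.integrableOn_speed
    (h.integrableOn_curvDensity.const_mul t), integral_const_mul, mul_comm]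

lemma volume_extDom_inter (h : OuterNormalFrame Ω γ N ε) (hne : Ω.Nonempty)
    (hb : IsBounded Ω) (hconv : Convex ℝ Ω) {R : ℝ} (hR : 0 < R) :
    volume.real (extDom Ω ∩ {x | infDist x (closure Ω) < R}) =
      (∫ s in Ico (0 : ℝ) 1, ‖deriv γ s‖) * R +
        (∫ s in Ico (0 : ℝ) 1, curvDensity N ε s) / 2 * R ^ 2 := by
  have hmeas : MeasurableSet {x : E2 | infDist x (closure Ω) < R} :=
    (isOpen_lt (continuous_infDist_pt _) continuous_const).measurableSet
  have hfin : volume {x : E2 | infDist x (closure Ω) < R} ≠ ⊤ := by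
    refine ((hb.closure.thickening (δ := R)).subset fun x hx => ?_).measure_lt_top.ne
    exact (mem_thickening_iff_infDist_lt hne.closure).2 hx
  have hind : (fun x : E2 => (Iio R).indicator (1 : ℝ → ℝ) (infDist x (closure Ω))) =
      {x : E2 | infDist x (closure Ω) < R}.indicator 1 := by
    ext x
    simp [indicator_apply]
  have hint : IntegrableOn
      (fun x : E2 => (Iio R).indicator (1 : ℝ → ℝ) (infDist x (closure Ω))) (extDom Ω) := by
    rw [hind]
    exact ((integrable_indicator_iff hmeas).2 (integrableOn_const (hs := hfin))).integrableOn
  have h1 := h.setIntegral_comp_infDist hne hb hconv hint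
  rw [hind, integral_indicator_one hmeas, measureReal_restrict_apply hmeas, inter_comm] at h1
  rw [h1]
  set l := ∫ s in Ico (0 : ℝ) 1, ‖deriv γ s‖
  set g := ∫ s in Ico (0 : ℝ) 1, curvDensity N ε s
  have h2 : ∀ t, (Iio R).indicator (1 : ℝ → ℝ) t * (l + t * g) =
      (Iio R).indicator (fun t => l + t * g) t := fun t => by
    by_cases ht : t < R <;> simp [ht]
  simp_rw [h2]
  rw [setIntegral_indicator measurableSet_Iio, Ioi_inter_Iio, ← integral_Ioc_eq_integral_Ioo,
    ← intervalIntegral.integral_of_le hR.le, intervalIntegral.integral_add (by simp)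
      (by apply Continuous.intervalIntegrable; fun_prop)]
  simp
  ring

/-- The total curvature of the boundary of a planar convex set is `2π`. -/
lemma integral_curvDensity (h : OuterNormalFrame Ω γ N ε) (hne : Ω.Nonempty)
    (hb : IsBounded Ω) (hconv : Convex ℝ Ω) :
    ∫ s in Ico (0 : ℝ) 1, curvDensity N ε s = 2 * π := by
  have hvol : ∀ R > (0 : ℝ), _ := fun R hR => h.volume_extDom_inter hne hb hconv (R := R) hR
  set l := ∫ s in Ico (0 : ℝ) 1, ‖deriv γ s‖
  set g := ∫ s in Ico (0 : ℝ) 1, curvDensity N ε s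
  have hl : 0 ≤ l := integral_nonneg fun s => norm_nonneg _
  have hball : ∀ (x : E2) (r : ℝ), 0 ≤ r → volume.real (ball x r) = π * r ^ 2 := fun x r hr => by
    rw [measureReal_def, EuclideanSpace.volume_ball_fin_two, ENNReal.toReal_mul,
      ENNReal.toReal_pow, ENNReal.toReal_ofReal hr]
    rw [ENNReal.toReal_ofReal pi_nonneg, mul_comm]
  have hquad : ∀ a b c : ℝ, (∀ R > 0, a * R ^ 2 ≤ b * R + c) → a ≤ 0 := fun a b c H => by
    by_contra! ha
    have h1 := H ((|b| + |c| + 1) / a + 1) (by positivity)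
    set q := (|b| + |c| + 1) / a with hq
    have h2 : a * q = |b| + |c| + 1 := by rw [hq]; field_simp
    have h3 : 0 ≤ q := by positivity
    nlinarith [le_abs_self b, le_abs_self c, abs_nonneg b, abs_nonneg c,
      mul_nonneg h3 (abs_nonneg c), mul_nonneg h3 (sub_nonneg.2 (le_abs_self b))]
  obtain ⟨x₀, hx₀⟩ := hne
  obtain ⟨D, hD⟩ := hb.closure.subset_closedBall x₀
  have hx₀' := subset_closure hx₀
  have hD0 : 0 ≤ D := by simpa using hD hx₀'
  have hfin : ∀ R, volume (ball x₀ R) ≠ ⊤ := fun R => measure_ball_lt_top.ne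
  have hsub : ∀ R, extDom Ω ∩ {x | infDist x (closure Ω) < R} ⊆ ball x₀ (R + D) :=
      fun R x hx => by
    obtain ⟨y, hy, hxy⟩ := (infDist_lt_iff ⟨x₀, hx₀'⟩).1 hx.2
    have := dist_triangle x y x₀
    have h2 := mem_closedBall.1 (hD hy)
    exact mem_ball.2 (by linarith)
  have hup : g / 2 - π ≤ 0 := hquad _ (2 * π * D) (π * D ^ 2) fun R hR => by
    have h1 := measureReal_mono (hsub R) (hfin _)
    rw [hvol R hR, hball _ _ (by linarith)] at h1
    nlinarith [mul_nonneg hl hR.le]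
  have hlow : π - g / 2 ≤ 0 := hquad _ l (volume.real (closure Ω)) fun R hR => by
    have hsub' : ball x₀ R ⊆
        closure Ω ∪ (extDom Ω ∩ {x | infDist x (closure Ω) < R}) := fun x hx => by
      by_cases hxc : x ∈ closure Ω
      · exact Or.inl hxc
      · exact Or.inr ⟨hxc, (infDist_le_dist_of_mem hx₀').trans_lt (mem_ball.1 hx)⟩
    have h1 := (measureReal_mono hsub' (measure_union_ne_top hb.closure.measure_lt_top.ne
      (measure_ne_top_of_subset (hsub R) (hfin _)))).trans (measureReal_union_le _ _)
    rw [hvol R hR, hball _ _ hR.le] at h1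
    linarith
  linarith

/-- A weak trace inequality on the exterior of a convex set. -/
lemma integral_curve_le (h : OuterNormalFrame Ω γ N ε) (hne : Ω.Nonempty)
    (hb : IsBounded Ω) (hconv : Convex ℝ Ω) {u : E2 → ℝ} (hu : ContDiff ℝ ∞ u)
    (hus : HasCompactSupport u) :
    ∫ s in Ico (0 : ℝ) 1, ‖deriv γ s‖ * u (γ s) ^ 2 ≤
      ∫ x in extDom Ω, 2 * |u x| * ‖fderiv ℝ u x‖ := by
  set F : E2 → ℝ := fun x => 2 * |u x| * ‖fderiv ℝ u x‖ with hF
  have hFc : Continuous F := by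
    have := hu.continuous
    have := hu.continuous_fderiv (by simp)
    fun_prop
  have hF0 : ∀ x, 0 ≤ F x := fun x => by positivity
  have hFs : HasCompactSupport F := by
    refine HasCompactSupport.mul_right (HasCompactSupport.mul_left ?_)
    exact hus.norm
  obtain ⟨h1, h2⟩ := h.change_of_variables hne hb hconv F
  have h3 := h1.1 (hFc.integrable_of_hasCompactSupport hFs).integrableOn
  rw [IntegrableOn, Measure.volume_eq_prod, ← Measure.prod_restrict] at h3
  rw [h2, Measure.volume_eq_prod, ← Measure.prod_restrict, integral_prod _ h3]
  refine integral_mono ?_ h3.integral_prod_left fun s => ?_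
  · have := hu.continuous
    have := h.contDiff_curve.continuous
    have := h.continuous_speed
    exact IntegrableOn.mono_set (Continuous.integrableOn_Icc (by fun_prop)) Ico_subset_Icc_self
  · have hiso : Isometry fun t : ℝ => γ s + t • N s := by
      refine Isometry.of_dist_eq fun t t' => ?_
      rw [dist_add_left, dist_eq_norm, ← sub_smul, norm_smul, h.norm_normal, mul_one,
        Real.dist_eq, Real.norm_eq_abs]
    have hline : HasCompactSupport fun t : ℝ => F (γ s + t • N s) :=
      hFs.comp_isClosedEmbedding hiso.isClosedEmbedding
    have hulines : HasCompactSupport fun t : ℝ => u (γ s + t • N s) :=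
      hus.comp_isClosedEmbedding hiso.isClosedEmbedding
    have hlinec : Continuous fun t : ℝ => F (γ s + t • N s) := hFc.comp hiso.continuous
    have hd : ∀ t : ℝ, HasDerivAt (fun t : ℝ => u (γ s + t • N s) ^ 2)
        (2 * u (γ s + t • N s) * fderiv ℝ u (γ s + t • N s) (N s)) t := fun t => by
      have hl : HasDerivAt (fun t : ℝ => γ s + t • N s) (N s) t := by
        simpa using ((hasDerivAt_id t).smul_const (N s)).const_add (γ s)
      have := ((hu.differentiable (by simp) (γ s + t • N s)).hasFDerivAt.comp_hasDerivAt t hl).pow 2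
      exact this.congr_deriv (by simp)
    have hdc : Continuous fun t : ℝ =>
        2 * u (γ s + t • N s) * fderiv ℝ u (γ s + t • N s) (N s) := by
      have h1 := hu.continuous.comp hiso.continuous
      have h2 := (hu.continuous_fderiv (by simp)).comp hiso.continuous
      exact (continuous_const.mul h1).mul (h2.clm_apply continuous_const)
    have hdi : Integrable fun t : ℝ =>
        2 * u (γ s + t • N s) * fderiv ℝ u (γ s + t • N s) (N s) :=
      hdc.integrable_of_hasCompactSupport (hulines.mul_left.mul_right)
    have hlim : Tendsto (fun t : ℝ => u (γ s + t • N s) ^ 2) atTop (𝓝 0) := by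
      have hs2 : HasCompactSupport fun t : ℝ => u (γ s + t • N s) ^ 2 := by
        simp_rw [pow_two]; exact hulines.mul_left
      exact hs2.is_zero_at_infty.mono_left atTop_le_cocompact
    have hftc := integral_Ioi_of_hasDerivAt_of_tendsto' (a := 0) (fun t _ => hd t)
      hdi.integrableOn hlim
    simp only [zero_smul, add_zero, zero_sub] at hftc
    have hbound : u (γ s) ^ 2 ≤ ∫ t in Ioi (0 : ℝ), F (γ s + t • N s) := by
      rw [← neg_neg (u (γ s) ^ 2), ← hftc, ← integral_neg]
      refine integral_mono hdi.neg.integrableOn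
        (hlinec.integrable_of_hasCompactSupport hline).integrableOn fun t => ?_
      refine (neg_le_abs _).trans ?_
      simp only [hF, abs_mul, abs_two]
      gcongr
      simpa [h.norm_normal] using (fderiv ℝ u (γ s + t • N s)).le_opNorm (N s)
    refine (mul_le_mul_of_nonneg_left hbound (norm_nonneg _)).trans ?_
    rw [← integral_const_mul]
    refine setIntegral_mono_on
      ((hlinec.integrable_of_hasCompactSupport hline).const_mul _).integrableOn ?_
      measurableSet_Ioi fun t ht => ?_
    · refine Integrable.integrableOn (Continuous.integrable_of_hasCompactSupport ?_ hline.mul_left)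
      have : Continuous fun t : ℝ => ‖deriv γ s‖ + t * curvDensity N ε s := by fun_prop
      exact this.mul hlinec
    · refine mul_le_mul_of_nonneg_right ?_ (hF0 _)
      exact le_add_of_nonneg_right (mul_nonneg (le_of_lt ht) (h.curvDensity_nonneg s))

lemma hausdorffMeasure_restrict_le (h : OuterNormalFrame Ω γ N ε) :
    ∃ K : ℝ≥0, (μH[1] : Measure E2).restrict (frontier Ω) ≤
      K • (volume.restrict (Ico (0 : ℝ) 1)).map γ := by
  obtain ⟨K, hK⟩ := (h.contDiff_curve.of_le (by simp) : ContDiff ℝ 1 γ).contDiffOn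
    |>.exists_lipschitzOnWith one_ne_zero (convex_Icc (0 : ℝ) 1) isCompact_Icc
  refine ⟨K, Measure.le_iff.2 fun A hA => ?_⟩
  have hc := h.contDiff_curve.continuous
  rw [Measure.restrict_apply hA, Measure.smul_apply, Measure.map_apply hc.measurable hA,
    Measure.restrict_apply (hc.measurable hA), ← h.image_eq, ← image_preimage_inter]
  have h1 := (hK.mono (inter_subset_right.trans Ico_subset_Icc_self :
    γ ⁻¹' A ∩ Ico 0 1 ⊆ Icc (0 : ℝ) 1)).hausdorffMeasure_image_le zero_le_one
  rwa [ENNReal.rpow_one, hausdorffMeasure_real] at h1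

lemma hausdorffMeasure_frontier_lt_top (h : OuterNormalFrame Ω γ N ε) :
    (μH[1] : Measure E2) (frontier Ω) < ⊤ := by
  obtain ⟨K, hK⟩ := h.hausdorffMeasure_restrict_le
  have h1 := hK univ
  rw [Measure.restrict_apply_univ] at h1
  refine h1.trans_lt ?_
  rw [Measure.smul_apply, Measure.map_apply h.contDiff_curve.continuous.measurable .univ]
  simp [ENNReal.smul_def]

lemma measureReal_image_le {γ : ℝ → E2} (hγ : ContDiff ℝ ∞ γ) {a b K : ℝ} (hab : a ≤ b)
    (hK : ∀ s ∈ Icc a b, ‖deriv γ s‖ ≤ K) :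
    (μH[1] : Measure E2).real (γ '' Ico a b) ≤ K * (b - a) := by
  have hK0 : 0 ≤ K := (norm_nonneg _).trans (hK a (left_mem_Icc.2 hab))
  lift K to ℝ≥0 using hK0
  have hlip : LipschitzOnWith K γ (Ico a b) :=
    ((convex_Icc a b).lipschitzOnWith_of_nnnorm_deriv_le
      (fun s _ => hγ.differentiable (by simp) s) fun s hs => hK s hs).mono Ico_subset_Icc_self
  have h1 := hlip.hausdorffMeasure_image_le zero_le_one
  rw [ENNReal.rpow_one, hausdorffMeasure_real, Real.volume_Ico] at h1
  have h2 := ENNReal.toReal_mono (by finiteness) h1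
  simpa [measureReal_def, ENNReal.toReal_mul, ENNReal.toReal_ofReal (sub_nonneg.2 hab)] using h2

lemma dist_le_measureReal_image {γ : ℝ → E2} (hγ : Continuous γ) {a b : ℝ} (hab : a ≤ b)
    (hfin : (μH[1] : Measure E2) (γ '' Ico a b) ≠ ⊤) :
    dist (γ b) (γ a) ≤ (μH[1] : Measure E2).real (γ '' Ico a b) := by
  have h1 := (LipschitzWith.dist_left (γ a)).hausdorffMeasure_image_le zero_le_one (γ '' Ico a b)
  rw [hausdorffMeasure_real, image_image] at h1
  have h2 := intermediate_value_Ico hab (f := fun s => dist (γ s) (γ a)) (by fun_prop)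
  have h3 := (measure_mono h2).trans h1
  rw [Real.volume_Ico] at h3
  have h4 := ENNReal.toReal_mono (by finiteness) h3
  simpa [measureReal_def] using h4

/-- The one-dimensional Hausdorff measure of the boundary is the length of the curve. -/
lemma hausdorffMeasure_frontier (h : OuterNormalFrame Ω γ N ε) :
    (μH[1] : Measure E2).real (frontier Ω) = ∫ s in Ico (0 : ℝ) 1, ‖deriv γ s‖ := by
  have hγ := h.contDiff_curve
  have hfin : ∀ {A : Set ℝ}, A ⊆ Ico 0 1 → (μH[1] : Measure E2) (γ '' A) ≠ ⊤ := fun hA =>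
    ((measure_mono ((image_mono hA).trans h.image_eq.subset)).trans_lt
      h.hausdorffMeasure_frontier_lt_top).ne
  let G : ℝ → ℝ := fun b => (μH[1] : Measure E2).real (γ '' Ico 0 b)
  have hG : ∀ a b, 0 ≤ a → a ≤ b → b ≤ 1 →
      G b - G a = (μH[1] : Measure E2).real (γ '' Ico a b) := fun a b ha hab hb => by
    have hsub : Ico a b ⊆ Ico 0 1 := Ico_subset_Ico ha hb
    have hsub' : Ico 0 a ⊆ Ico 0 1 := Ico_subset_Ico_right (hab.trans hb)
    have hmeas : MeasurableSet (γ '' Ico a b) :=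
      measurableSet_Ico.image_of_continuousOn_injOn hγ.continuous.continuousOn (h.injOn.mono hsub)
    have hdisj : Disjoint (γ '' Ico 0 a) (γ '' Ico a b) :=
      disjoint_image_image fun x hx y hy hxy =>
        (hx.2.trans_le hy.1).ne (h.injOn (hsub' hx) (hsub hy) hxy)
    have := measureReal_union hdisj hmeas (hfin hsub') (hfin hsub)
    rw [← image_union, Ico_union_Ico_eq_Ico ha hab] at this
    simp only [G, this]
    ring
  obtain ⟨K, hK⟩ := isCompact_Icc.exists_bound_of_continuousOn (s := Icc (0 : ℝ) 1)
    (hγ.continuous_deriv (by simp)).continuousOn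
  have hK0 : 0 ≤ K := (norm_nonneg _).trans (hK 0 (by simp))
  have hcont : ContinuousOn G (Icc 0 1) := by
    refine (LipschitzOnWith.of_le_add_mul (Real.toNNReal K) fun x hx y hy => ?_).continuousOn
    rw [Real.coe_toNNReal _ hK0, Real.dist_eq]
    rcases le_total x y with hxy | hxy
    · have h1 := hG x y hx.1 hxy hy.2
      have h2 : 0 ≤ (μH[1] : Measure E2).real (γ '' Ico x y) := measureReal_nonneg
      have h3 : 0 ≤ K * |x - y| := by positivity
      linarith
    · have h1 := hG y x hy.1 hxy hx.2
      have h2 := measureReal_image_le hγ hxy (K := K) fun s hs =>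
        hK s ⟨hy.1.trans hs.1, hs.2.trans hx.2⟩
      rw [abs_of_nonneg (sub_nonneg.2 hxy)]
      linarith
  have hderiv : ∀ a ∈ Ioo (0 : ℝ) 1, HasDerivWithinAt G ‖deriv γ a‖ (Ioi a) a := fun a ha => by
    rw [hasDerivWithinAt_iff_tendsto_slope' self_notMem_Ioi]
    have hev1 : ∀ᶠ b in 𝓝[>] a, b ∈ Ioo a 1 := Ioo_mem_nhdsGT ha.2
    refine tendsto_order.2 ⟨fun c hc => ?_, fun c hc => ?_⟩
    · have hs := ((hγ.differentiable (by simp) a).hasDerivAt.tendsto_slope.mono_left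
        (nhdsWithin_mono a fun b (hb : a < b) => hb.ne')).norm
      filter_upwards [hs.eventually (lt_mem_nhds hc), hev1] with b hb hab
      refine hb.trans_le ?_
      have hpos : 0 < b - a := sub_pos.2 hab.1
      have h1 := dist_le_measureReal_image hγ.continuous hab.1.le
        (hfin (Ico_subset_Ico ha.1.le hab.2.le))
      rw [← hG a b ha.1.le hab.1.le hab.2.le, dist_eq_norm] at h1
      rw [slope_def_module, slope_def_field, norm_smul, norm_inv, Real.norm_eq_abs,
        abs_of_pos hpos, inv_mul_eq_div]
      exact div_le_div_of_nonneg_right h1 hpos.le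
    · obtain ⟨K', hK1, hK2⟩ := exists_between hc
      have hnhds := h.continuous_speed.continuousAt.eventually (gt_mem_nhds hK1)
      obtain ⟨r, hr, hball⟩ := Metric.eventually_nhds_iff.1 hnhds
      have hev2 : ∀ᶠ b in 𝓝[>] a, b ∈ Ioo a (a + r) := Ioo_mem_nhdsGT (by linarith)
      filter_upwards [hev1, hev2] with b hab hb
      have hpos : 0 < b - a := sub_pos.2 hab.1
      have h1 := measureReal_image_le hγ hab.1.le (K := K') fun s hs => (hball (by
        rw [Real.dist_eq, abs_of_nonneg (sub_nonneg.2 hs.1)]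
        linarith [hs.2, hb.2])).le
      rw [← hG a b ha.1.le hab.1.le hab.2.le] at h1
      rw [slope_def_field]
      exact ((div_le_iff₀ hpos).2 h1).trans_lt hK2
  have hftc := intervalIntegral.integral_eq_sub_of_hasDeriv_right_of_le zero_le_one hcont hderiv
    (h.continuous_speed.intervalIntegrable 0 1)
  rw [integral_Ico_eq_integral_Ioc, ← intervalIntegral.integral_of_le zero_le_one, hftc]
  simp [G, h.image_eq]

/-- The boundary term is controlled by the parametrized boundary integral. -/
lemma exists_integral_frontier_le (h : OuterNormalFrame Ω γ N ε) :
    ∃ K : ℝ, 0 ≤ K ∧ ∀ u : E2 → ℝ, Continuous u →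
      ∫ x in frontier Ω, u x ^ 2 ∂μH[1] ≤
        K * ∫ s in Ico (0 : ℝ) 1, ‖deriv γ s‖ * u (γ s) ^ 2 := by
  obtain ⟨K, hK⟩ := h.hausdorffMeasure_restrict_le
  obtain ⟨s₀, -, hs₀⟩ := isCompact_Icc.exists_isMinOn (nonempty_Icc.2 zero_le_one)
    (h.continuous_speed.continuousOn (s := Icc (0 : ℝ) 1))
  set m := ‖deriv γ s₀‖ with hm
  have hm0 : 0 < m := h.speed_pos s₀
  refine ⟨K / m, by positivity, fun u hu => ?_⟩
  have hγ := h.contDiff_curve.continuous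
  have hγm : AEMeasurable γ (volume.restrict (Ico (0 : ℝ) 1)) := hγ.aemeasurable
  have hv := h.continuous_speed
  have hint : ∀ {f : ℝ → ℝ}, Continuous f → IntegrableOn f (Ico (0 : ℝ) 1) := fun hf =>
    hf.integrableOn_Icc.mono_set Ico_subset_Icc_self
  have hmeas : AEStronglyMeasurable (fun x => u x ^ 2)
      ((volume.restrict (Ico (0 : ℝ) 1)).map γ) := (hu.pow 2).aestronglyMeasurable
  have hint' : Integrable (fun x => u x ^ 2) ((volume.restrict (Ico (0 : ℝ) 1)).map γ) :=
    (integrable_map_measure hmeas hγm).2 (hint (by fun_prop : Continuous fun s => u (γ s) ^ 2))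
  have h1 := integral_mono_measure hK (f := fun x => u x ^ 2)
    (Eventually.of_forall fun x => sq_nonneg _) hint'.smul_measure_nnreal
  refine h1.trans ?_
  rw [integral_smul_nnreal_measure, integral_map hγm hmeas, NNReal.smul_def, smul_eq_mul,
    div_mul_eq_mul_div, mul_div_assoc]
  refine mul_le_mul_of_nonneg_left ?_ K.2
  rw [le_div_iff₀ hm0, mul_comm, ← integral_const_mul]
  refine setIntegral_mono_on (hint (by fun_prop)) (hint (by fun_prop)) measurableSet_Ico
    fun s hs => ?_
  exact mul_le_mul_of_nonneg_right (hs₀ (Ico_subset_Icc_self hs)) (sq_nonneg _)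

end OuterNormalFrame

lemma hasCompactSupport_comp_of_dist_infDist_le {K : Set E2} (hK : K.Nonempty)
    (hKb : IsBounded K) {f : ℝ → ℝ} (hfs : HasCompactSupport f) {ρ : E2 → ℝ} {δ : ℝ}
    (hρ : ∀ x, |ρ x - infDist x K| ≤ δ) : HasCompactSupport fun x => f (ρ x) := by
  obtain ⟨R, hR⟩ := hfs.exists_forall_lt_eq_zero
  exact HasCompactSupport.of_support_subset_isCompact
    (isCompact_of_isClosed_isBounded isClosed_cthickening hKb.cthickening)
    (support_comp_subset_cthickening hK hR hρ)

lemma integral_weighted_sq_pos {ψ : ℝ → ℝ} (hψ : Continuous ψ) (hsupp : HasCompactSupport ψ)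
    (hnz : ∃ t : ℝ, 0 ≤ t ∧ ψ t ≠ 0) {L : ℝ} (hL : 0 ≤ L) :
    0 < ∫ t in Ioi (0 : ℝ), ψ t ^ 2 * (L + 2 * π * t) := by
  obtain ⟨t₀, ht₀, hψt₀⟩ := hnz
  have hint : Integrable fun t => ψ t ^ 2 * (L + 2 * π * t) := by
    refine Continuous.integrable_of_hasCompactSupport (by fun_prop) ?_
    simp_rw [pow_two]
    exact hsupp.mul_left.mul_right
  rw [setIntegral_pos_iff_support_of_nonneg_ae ?_ hint.integrableOn]
  · have hopen : IsOpen ({t | ψ t ≠ 0} ∩ Ioi 0) :=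
      (isOpen_ne_fun hψ continuous_const).inter isOpen_Ioi
    have hev : ∀ᶠ t in 𝓝[>] t₀, t ∈ {t | ψ t ≠ 0} ∩ Ioi 0 := by
      filter_upwards [(hψ.continuousAt.eventually_ne hψt₀).filter_mono nhdsWithin_le_nhds,
        self_mem_nhdsWithin] with t h1 h2
      exact ⟨h1, ht₀.trans_lt h2⟩
    refine (hopen.measure_pos volume hev.exists).trans_le (measure_mono fun t ht => ⟨?_, ht.2⟩)
    have h1 : 0 < 2 * π * t := mul_pos two_pi_pos ht.2
    exact mul_ne_zero (pow_ne_zero 2 ht.1) (by positivity)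
  · refine (ae_restrict_iff' measurableSet_Ioi).2 (Eventually.of_forall fun t ht => ?_)
    have h1 : 0 < 2 * π * t := mul_pos two_pi_pos ht
    simp only [Pi.zero_apply]
    positivity

/-- The Rayleigh quotients defining `robinEig`. -/
def rayleighSet (α : ℝ) (Ω : Set E2) : Set ℝ :=
  { q : ℝ | ∃ u : E2 → ℝ, ContDiff ℝ (⊤ : ℕ∞) u ∧ HasCompactSupport u ∧
    (∃ x ∈ extDom Ω, u x ≠ 0) ∧
    q = ((∫ x in extDom Ω, ‖fderiv ℝ u x‖ ^ 2) +
          α * ∫ x in frontier Ω, (u x) ^ 2 ∂(μH[1])) /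
        (∫ x in extDom Ω, (u x) ^ 2) }

lemma robinEig_le {α : ℝ} {Ω : Set E2} (hbdd : BddBelow (rayleighSet α Ω)) {u : E2 → ℝ}
    (hu : ContDiff ℝ ∞ u) (hus : HasCompactSupport u) (hne : ∃ x ∈ extDom Ω, u x ≠ 0) :
    robinEig α Ω ≤ ((∫ x in extDom Ω, ‖fderiv ℝ u x‖ ^ 2) +
      α * ∫ x in frontier Ω, (u x) ^ 2 ∂(μH[1])) / (∫ x in extDom Ω, (u x) ^ 2) :=
  csInf_le hbdd ⟨u, hu, hus, hne, rfl⟩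

lemma OuterNormalFrame.bddBelow_rayleigh {Ω : Set E2} {γ N : ℝ → E2} {ε : ℝ}
    (h : OuterNormalFrame Ω γ N ε) (hne : Ω.Nonempty) (hb : IsBounded Ω) (hconv : Convex ℝ Ω)
    (α : ℝ) : BddBelow (rayleighSet α Ω) := by
  obtain ⟨K, hK0, hK⟩ := h.exists_integral_frontier_le
  refine ⟨-(|α| * K) ^ 2, ?_⟩
  rintro _ ⟨u, hu, hus, -, rfl⟩
  have hc := hu.continuous
  have hc' := hu.continuous_fderiv (by simp)
  have hB := (hK u hc).trans
    (mul_le_mul_of_nonneg_left (h.integral_curve_le hne hb hconv hu hus) hK0)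
  have hB0 : 0 ≤ ∫ x in frontier Ω, u x ^ 2 ∂μH[1] := integral_nonneg fun x => sq_nonneg _
  have hC0 : 0 ≤ ∫ x in extDom Ω, u x ^ 2 := integral_nonneg fun x => sq_nonneg _
  have hus2 : HasCompactSupport fun x => u x ^ 2 := by
    simp_rw [pow_two]; exact hus.mul_left
  have hfs2 : HasCompactSupport fun x => ‖fderiv ℝ u x‖ ^ 2 := by
    simp_rw [pow_two]; exact (hus.fderiv ℝ).norm.mul_left
  have hi1 : IntegrableOn (fun x => u x ^ 2) (extDom Ω) :=
    (Continuous.integrable_of_hasCompactSupport (by fun_prop) hus2).integrableOn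
  have hi2 : IntegrableOn (fun x => ‖fderiv ℝ u x‖ ^ 2) (extDom Ω) :=
    (Continuous.integrable_of_hasCompactSupport (by fun_prop) hfs2).integrableOn
  have hi3 : IntegrableOn (fun x => 2 * |u x| * ‖fderiv ℝ u x‖) (extDom Ω) := by
    refine (Continuous.integrable_of_hasCompactSupport (by fun_prop) ?_).integrableOn
    exact (HasCompactSupport.mul_left hus.norm).mul_right
  have hyoung : |α| * K * ∫ x in extDom Ω, 2 * |u x| * ‖fderiv ℝ u x‖ ≤
      (∫ x in extDom Ω, ‖fderiv ℝ u x‖ ^ 2) + (|α| * K) ^ 2 * ∫ x in extDom Ω, u x ^ 2 := by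
    rw [← integral_const_mul, ← integral_const_mul, ← integral_add hi2 (hi1.const_mul _)]
    refine integral_mono (hi3.const_mul _) (hi2.add (hi1.const_mul _)) fun x => ?_
    simp only
    rw [← sq_abs (u x)]
    nlinarith [sq_nonneg (‖fderiv ℝ u x‖ - |α| * K * |u x|)]
  have hα := mul_le_mul_of_nonneg_right (neg_abs_le α) hB0
  have hα' := mul_le_mul_of_nonneg_left hB (abs_nonneg α)
  rcases hC0.eq_or_lt with h0 | hpos
  · rw [← h0, div_zero]
    exact neg_nonpos.2 (sq_nonneg _)
  · rw [le_div_iff₀ hpos]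
    linarith

/-- Test-function bound for the exterior eigenvalue via parallel coordinates. -/
theorem robinEig_parallel_coordinates_bound
    (α : ℝ) (Ω : Set E2) (hne : Ω.Nonempty) (ho : IsOpen Ω) (hb : IsBounded Ω)
    (hconv : Convex ℝ Ω) (hsm : HasSmoothBoundary Ω)
    (L : ℝ) (hL : L = (μH[1] (frontier Ω)).toReal)
    (ψ : ℝ → ℝ) (hψ : ContDiff ℝ (⊤ : ℕ∞) ψ) (hsupp : HasCompactSupport ψ)
    (hnz : ∃ t : ℝ, 0 ≤ t ∧ ψ t ≠ 0) :
    robinEig α Ω ≤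
      ((∫ t in Ioi (0:ℝ), (deriv ψ t) ^ 2 * (L + 2 * π * t)) + α * L * (ψ 0) ^ 2) /
        (∫ t in Ioi (0:ℝ), (ψ t) ^ 2 * (L + 2 * π * t)) := by
  obtain ⟨γ, N, ε, hfr⟩ := exists_outerNormalFrame hne ho hconv hsm
  set K := closure Ω
  have hLr : L = (μH[1] : Measure E2).real (frontier Ω) := hL
  have hL0 : 0 ≤ L := hLr ▸ measureReal_nonneg
  have : IsFiniteMeasure ((μH[1] : Measure E2).restrict (frontier Ω)) :=
    ⟨by simpa using hfr.hausdorffMeasure_frontier_lt_top⟩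
  have hψ' : Continuous (deriv ψ) := hψ.continuous_deriv (by simp)
  have hψ2s : HasCompactSupport fun t => ψ t ^ 2 := by
    simp_rw [pow_two]; exact hsupp.mul_left
  have hψ'2s : HasCompactSupport fun t => deriv ψ t ^ 2 := by
    simp_rw [pow_two]; exact hsupp.deriv.mul_left
  choose ρ hρsmooth hρlip hρdist using fun n : ℕ =>
    (lipschitz_infDist_pt K).exists_contDiff_lipschitz_dist_le (δ := 1 / ((n : ℝ) + 1))
      (by positivity)
  have hconvg : ∀ {μ : Measure E2} [IsFiniteMeasureOnCompacts μ] {f : ℝ → ℝ}, Continuous f →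
      HasCompactSupport f → Tendsto (fun n => ∫ x, f (ρ n x) ∂μ) atTop
        (𝓝 (∫ x, f (infDist x K) ∂μ)) := fun hf hfs =>
    tendsto_integral_comp_infDist hne.closure hb.closure hf hfs
      (fun n => (hρsmooth n).continuous) hρdist
  have hsteiner : ∀ {f : ℝ → ℝ}, Continuous f → HasCompactSupport f →
      ∫ x in extDom Ω, f (infDist x K) = ∫ t in Ioi (0 : ℝ), f t * (L + 2 * π * t) :=
      fun {f} hf hfs => by
    rw [hfr.setIntegral_comp_infDist hne hb hconv, ← hfr.hausdorffMeasure_frontier,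
      hfr.integral_curvDensity hne hb hconv, ← hLr]
    · simp_rw [mul_comm (2 * π)]
    · refine Integrable.integrableOn (Continuous.integrable_of_hasCompactSupport (by fun_prop) ?_)
      exact hasCompactSupport_comp_of_dist_infDist_le hne.closure hb.closure hfs (δ := 0)
        (by simp)
  have hA := hconvg (μ := volume.restrict (extDom Ω)) (hψ'.pow 2) hψ'2s
  have hC := hconvg (μ := volume.restrict (extDom Ω)) (hψ.continuous.pow 2) hψ2s
  have hB := hconvg (μ := (μH[1] : Measure E2).restrict (frontier Ω)) (hψ.continuous.pow 2) hψ2s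
  simp only [Pi.pow_apply] at hA hB hC
  rw [hsteiner (f := fun t => deriv ψ t ^ 2) (hψ'.pow 2) hψ'2s] at hA
  rw [hsteiner (f := fun t => ψ t ^ 2) (hψ.continuous.pow 2) hψ2s] at hC
  have hB0 : ∫ x in frontier Ω, ψ (infDist x K) ^ 2 ∂μH[1] = L * ψ 0 ^ 2 := by
    have heq : EqOn (fun x => ψ (infDist x K) ^ 2) (fun _ => ψ 0 ^ 2) (frontier Ω) := fun x hx => by
      simp only [infDist_zero_of_mem (show x ∈ K from frontier_subset_closure hx)]
    rw [setIntegral_congr_fun isClosed_frontier.measurableSet heq]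
    simp [hLr, measureReal_def]
  rw [hB0] at hB
  have hCpos : 0 < ∫ t in Ioi (0 : ℝ), ψ t ^ 2 * (L + 2 * π * t) :=
    integral_weighted_sq_pos hψ.continuous hsupp hnz hL0
  have hlim := (hA.add (hB.const_mul α)).div hC hCpos.ne'
  rw [← mul_assoc] at hlim
  refine ge_of_tendsto hlim ?_
  filter_upwards [hC.eventually (lt_mem_nhds hCpos)] with n hn
  have hu : ContDiff ℝ ∞ fun x => ψ (ρ n x) := hψ.comp (hρsmooth n)
  refine (robinEig_le (hfr.bddBelow_rayleigh hne hb hconv α) hu ?_ ?_).trans ?_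
  · exact hasCompactSupport_comp_of_dist_infDist_le hne.closure hb.closure hsupp (hρdist n)
  · by_contra! h0
    have heq : EqOn (fun x => ψ (ρ n x) ^ 2) (fun _ => 0) (extDom Ω) := fun x hx => by
      simp [h0 x hx]
    have hm : MeasurableSet (extDom Ω) := isClosed_closure.isOpen_compl.measurableSet
    rw [setIntegral_congr_fun hm heq] at hn
    simp at hn
  · refine div_le_div_of_nonneg_right (add_le_add_left ?_ _) hn.le
    have hsm2 := hasCompactSupport_comp_of_dist_infDist_le hne.closure hb.closure hψ'2s (hρdist n)
    have hbd : ∀ x, ‖fderiv ℝ (fun x => ψ (ρ n x)) x‖ ≤ |deriv ψ (ρ n x)| := fun x => by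
      have h1 := (hψ.differentiable (by simp) (ρ n x)).hasDerivAt.comp_hasFDerivAt x
        ((hρsmooth n).differentiable (by simp) x).hasFDerivAt
      have h2 := h1.fderiv
      rw [Function.comp_def] at h2
      rw [h2, norm_smul, Real.norm_eq_abs]
      have h3 := norm_fderiv_le_of_lipschitz ℝ (hρlip n) (x₀ := x)
      exact mul_le_of_le_one_right (abs_nonneg _) (by simpa using h3)
    refine integral_mono_of_nonneg (Eventually.of_forall fun x => sq_nonneg _) ?_
      (Eventually.of_forall fun x => ?_)
    · have := (hρsmooth n).continuous
      exact (Continuous.integrable_of_hasCompactSupport (by fun_prop) hsm2).integrableOn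
    · simp only
      rw [← sq_abs (deriv ψ _)]
      gcongr
      exact hbd x

end
end
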